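/- A priori bound for the extended PDE system: let T > 0 and let 𝔶, 𝔶̃ : [0,T] → 𝒯_0 satisfy C_t := ∫_0^t ‖𝔶(r)‖_1 dr < ∞ and C̃_t := ∫_0^t ‖𝔶̃(r)‖_1 dr < ∞ for all t ∈ [0,T]. Suppose (u, φ, φ̃) : [0,T]² → ℝ × 𝒯^1 × 𝒯^1 is continuous and satisfies: u(s,t) = u(s,0) + u(0,t) − u(0,0) + ∫_0^s∫_0^t { u(r,v)⟨𝔶(r), 𝔶̃(v)⟩ + ⟨φ(r,v), 𝔶(r) ⊲₀ 𝔶̃(v)⟩ + ⟨φ̃(r,v), 𝔶̃(v) ⊲₀ 𝔶(r)⟩ } dv dr; φ(s,t) = ∫_0^s { u(r,t)𝔶(r) + φ(r,t) ⊗ 𝔶(r) + φ̃(r,t) ⊳₀ 𝔶(r) } dr; φ̃(s,t) = ∫_0^t { u(s,r)𝔶̃(r) + φ̃(s,r) ⊗ 𝔶̃(r) + φ(s,r) ⊳₀ 𝔶̃(r) } dr. Then for all s, t ∈ [0,T]: |u(s,t)| + ‖φ(s,t)‖_1 ≤ ψ(C_s, C̃_t) · sup_{(r,v)∈[0,s]×[0,t]}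 |u(r,0) + u(0,v) − u(0,0)|, and the same bound holds with ‖φ̃(s,t)‖_1 in place of ‖φ(s,t)‖_1, where ψ(x,y) = e^{x+y} I_0(2√(xy)) and I_0(z) = ∑_{k≥0} (z/2)^{2k}/(k!)² is the modified Bessel function of order zero. -/

import Mathlib

open scoped BigOperators ENNReal
open MeasureTheory

/-- Words of length `n` over the alphabet `{1,…,d}`: indices of a basis of `V^{⊗n}`, `V ≅ ℝ^d`. -/
abbrev Word (d n : ℕ) := Fin n → Fin d

/-- The extended tensor algebra `𝒯 = ∏_{n ≥ 0} V^{⊗n}` over `V ≅ ℝ^d`, represented by the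
coefficients of tensor series in the word basis. -/
abbrev TS (d : ℕ) := ∀ n : ℕ, Word d n → ℝ

namespace TS

variable {d : ℕ}

/-- Euclidean norm `|x^{(n)}|` of the `n`-th homogeneous component. -/
noncomputable def levelNorm (x : TS d) (n : ℕ) : ℝ :=
  Real.sqrt (∑ w : Word d n, (x n w) ^ 2)

/-- The `ℓ^p`-type norm `‖x‖_p = (∑_n |x^{(n)}|^p)^{1/p}`, valued in `[0,∞]`. -/
noncomputable def pNorm (p : ℝ) (x : TS d) : ℝ≥0∞ :=
  (∑' n : ℕ, ENNReal.ofReal (levelNorm x n) ^ p) ^ (1 / p)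

/-- The unit `1` of the tensor algebra. -/
def one : TS d := fun n _ => if n = 0 then 1 else 0

/-- The zero tensor series. -/
def zero : TS d := fun _ _ => 0

def add (x y : TS d) : TS d := fun n w => x n w + y n w

def sub (x y : TS d) : TS d := fun n w => x n w - y n w

def smul (c : ℝ) (x : TS d) : TS d := fun n w => c * x n w

/-- The (concatenation) tensor product: `(x ⊗ y)^{(n)} = ∑_{k=0}^n x^{(k)} ⊗ y^{(n-k)}`. -/
def mul (x y : TS d) : TS d := fun n w =>
  ∑ k : Fin (n + 1),
    x k.1 (fun i => w ⟨i.1, by have h1 := i.2; have h2 := k.2; omega⟩) *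
      y (n - k.1) (fun i => w ⟨k.1 + i.1, by have h1 := i.2; have h2 := k.2; omega⟩)

/-- The dual pairing `⟨x, y⟩ = ∑_n ⟨x^{(n)}, y^{(n)}⟩`. -/
noncomputable def pairing (x y : TS d) : ℝ :=
  ∑' n : ℕ, ∑ w : Word d n, x n w * y n w

/-- Projection `π_m` to the `m`-th homogeneous level. -/
def proj (m : ℕ) (x : TS d) : TS d := fun n w => if n = m then x n w else 0

/-- Truncation `π_{(0,N)}` to levels `≤ N`. -/
def truncate (N : ℕ) (x : TS d) : TS d := fun n w => if n ≤ N then x n w else 0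

/-- Removing the scalar (level-0) component. -/
def reduce (x : TS d) : TS d := fun n w => if n = 0 then 0 else x n w

/-- The dilation `δ_c`, multiplying the `n`-th level by `c^n`. -/
def dil (c : ℝ) (x : TS d) : TS d := fun n w => c ^ n * x n w

/-- The adjoint `x ⊳ z` of left tensor multiplication: `(x ⊳ z)^w = ⟨z, x ⊗ e_w⟩`. -/
noncomputable def adjL (x z : TS d) : TS d := fun n w =>
  ∑' k : ℕ, ∑ v : Word d k, x k v * z (k + n) (Fin.append v w)

/-- The adjoint `x ⊲ z` of right tensor multiplication: `(x ⊲ z)^w = ⟨z, e_w ⊗ x⟩`. -/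
noncomputable def adjR (x z : TS d) : TS d := fun n w =>
  ∑' k : ℕ, ∑ v : Word d k, x k v * z (n + k) (Fin.append w v)

/-- `S` is the free development of the (componentwise a.c.) path `γ = ∫_0^· γ'(u) du` started
at time `s`: it solves, componentwise, `S(t) = 1 + ∫_s^t S(u) ⊗ γ'(u) du`, all components of the
integrand being interval integrable. -/
def IsDev (γ' : ℝ → TS d) (s : ℝ) (S : ℝ → TS d) : Prop :=
  (∀ t n w, IntervalIntegrable (fun u => mul (S u) (γ' u) n w) volume s t) ∧
    ∀ t, s ≤ t → ∀ n w,
      S t n w = (one : TS d) n w + ∫ u in s..t, mul (S u) (γ' u) n w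

end TS

/-- The modified Bessel function of the first kind of order zero,
`I₀(z) = ∑_{k ≥ 0} (z/2)^{2k}/(k!)²`. -/
noncomputable def besselI0 (z : ℝ) : ℝ :=
  ∑' k : ℕ, (z / 2) ^ (2 * k) / ((k.factorial : ℝ)) ^ 2

namespace TS

variable {d : ℕ}

/-- Continuity of a two-parameter `𝒯`-valued map on a set, with respect to `‖·‖_1`. -/
def Cont1On (F : ℝ → ℝ → TS d) (A : Set (ℝ × ℝ)) : Prop :=
  ∀ p ∈ A, ∀ ε : ℝ, 0 < ε → ∃ δ : ℝ, 0 < δ ∧ ∀ q ∈ A,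
    dist q p < δ → pNorm 1 (sub (F q.1 q.2) (F p.1 p.2)) < ENNReal.ofReal ε

end TS


open scoped BigOperators ENNReal
open MeasureTheory

/-- iterated integrals -/
noncomputable def itJ (a : ℝ → ℝ≥0∞) : ℕ → ℝ → ℝ≥0∞
  | 0 => fun _ => 1
  | n + 1 => fun s => ∫⁻ r in Set.Ioc (0:ℝ) s, a r * itJ a n r

theorem measurable_itint (f : ℝ → ℝ≥0∞) :
    Measurable (fun s : ℝ => ∫⁻ r in Set.Ioc (0:ℝ) s, f r) := by
  apply Monotone.measurable
  intro s t h
  exact lintegral_mono_set (Set.Ioc_subset_Ioc_right h)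

theorem measurable_itJ (a : ℝ → ℝ≥0∞) (n : ℕ) : Measurable (itJ a n) := by
  cases n with
  | zero => exact measurable_const
  | succ n => exact measurable_itint _

theorem tri_swap (a f : ℝ → ℝ≥0∞) (ha : Measurable a) (hf : Measurable f) (s : ℝ) :
    ∫⁻ v in Set.Ioc (0:ℝ) s, f v * ∫⁻ r in Set.Ioc v s, a r
      = ∫⁻ r in Set.Ioc (0:ℝ) s, a r * ∫⁻ v in Set.Ioc (0:ℝ) r, f v := by
  have hm : Measurable (fun p : ℝ × ℝ => (Set.indicator {q : ℝ × ℝ | 0 < q.1 ∧ q.1 < q.2 ∧ q.2 ≤ s}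
      (fun q => f q.1 * a q.2)) p) := by
    apply Measurable.indicator
    · exact (hf.comp measurable_fst).mul (ha.comp measurable_snd)
    · apply MeasurableSet.inter
      · exact measurableSet_lt measurable_const measurable_fst
      · exact (measurableSet_lt measurable_fst measurable_snd).inter
          (measurableSet_le measurable_snd measurable_const)
  have key := lintegral_lintegral_swap (μ := (volume : Measure ℝ)) (ν := (volume : Measure ℝ))
    (f := fun v r => (Set.indicator {q : ℝ × ℝ | 0 < q.1 ∧ q.1 < q.2 ∧ q.2 ≤ s}
      (fun q => f q.1 * a q.2)) (v, r)) hm.aemeasurable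
  have e1 : ∀ v, ∫⁻ r, (Set.indicator {q : ℝ × ℝ | 0 < q.1 ∧ q.1 < q.2 ∧ q.2 ≤ s}
      (fun q => f q.1 * a q.2)) (v, r) =
      (Set.Ioc (0:ℝ) s).indicator (fun v => f v * ∫⁻ r in Set.Ioc v s, a r) v := by
    intro v
    by_cases hv : v ∈ Set.Ioc (0:ℝ) s
    · rw [Set.indicator_of_mem hv, ← lintegral_indicator measurableSet_Ioc,
        ← lintegral_const_mul _ (ha.indicator measurableSet_Ioc)]
      congr 1; ext r
      by_cases hr : r ∈ Set.Ioc v s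
      · rw [Set.indicator_of_mem hr, Set.indicator_of_mem]
        exact ⟨hv.1, hr.1, hr.2⟩
      · rw [Set.indicator_of_notMem hr, Set.indicator_of_notMem, mul_zero]
        intro h; exact hr ⟨h.2.1, h.2.2⟩
    · rw [Set.indicator_of_notMem hv]
      rw [lintegral_eq_zero_iff' (by
        exact (hm.comp (measurable_const.prodMk measurable_id)).aemeasurable)]
      refine Filter.Eventually.of_forall fun r => ?_
      show Set.indicator _ _ _ = _
      rw [Set.indicator_of_notMem]; · rfl
      intro h; exact hv ⟨h.1, h.2.1.le.trans h.2.2⟩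
  have e2 : ∀ r, ∫⁻ v, (Set.indicator {q : ℝ × ℝ | 0 < q.1 ∧ q.1 < q.2 ∧ q.2 ≤ s}
      (fun q => f q.1 * a q.2)) (v, r) =
      (Set.Ioc (0:ℝ) s).indicator (fun r => a r * ∫⁻ v in Set.Ioc (0:ℝ) r, f v) r := by
    intro r
    by_cases hr : r ∈ Set.Ioc (0:ℝ) s
    · rw [Set.indicator_of_mem hr, ← restrict_Ioo_eq_restrict_Ioc,
        ← lintegral_indicator measurableSet_Ioo,
        ← lintegral_const_mul _ (hf.indicator measurableSet_Ioo)]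
      congr 1; ext v
      by_cases hv : v ∈ Set.Ioo 0 r
      · rw [Set.indicator_of_mem hv, Set.indicator_of_mem, mul_comm]
        exact ⟨hv.1, hv.2, hr.2⟩
      · rw [Set.indicator_of_notMem hv, Set.indicator_of_notMem, mul_zero]
        intro h; exact hv ⟨h.1, h.2.1⟩
    · rw [Set.indicator_of_notMem hr]
      rw [lintegral_eq_zero_iff' (by
        exact (hm.comp (measurable_id.prodMk measurable_const)).aemeasurable)]
      refine Filter.Eventually.of_forall fun v => ?_
      show Set.indicator _ _ _ = _
      rw [Set.indicator_of_notMem]; · rfl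
      intro h; exact hr ⟨h.1.trans h.2.1, h.2.2⟩
  simp_rw [e1, e2] at key
  rwa [lintegral_indicator measurableSet_Ioc, lintegral_indicator measurableSet_Ioc] at key

theorem itJ_mul (a : ℝ → ℝ≥0∞) (ha : Measurable a) (n : ℕ) (s : ℝ) :
    (∫⁻ r in Set.Ioc (0:ℝ) s, a r) * itJ a n s = (n + 1 : ℕ) * itJ a (n + 1) s := by
  induction n generalizing s with
  | zero => simp [itJ]
  | succ n ih =>
    have hm := measurable_itJ a n
    have hm1 := measurable_itJ a (n+1)
    have hp : Measurable (fun r => a r * itJ a n r) := ha.mul hm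
    have hp1 : Measurable (fun r => a r * itJ a (n+1) r) := ha.mul hm1
    have h1 : (∫⁻ r in Set.Ioc (0:ℝ) s, a r) * itJ a (n+1) s =
        ∫⁻ v in Set.Ioc (0:ℝ) s, ((n + 1 : ℕ) * (a v * itJ a (n+1) v) +
          (a v * itJ a n v) * ∫⁻ r in Set.Ioc v s, a r) := by
      show _ * (∫⁻ r in Set.Ioc (0:ℝ) s, a r * itJ a n r) = _
      rw [← lintegral_const_mul _ hp]
      refine setLIntegral_congr_fun measurableSet_Ioc fun v hv => ?_
      have : (∫⁻ r in Set.Ioc (0:ℝ) s, a r) = (∫⁻ r in Set.Ioc (0:ℝ) v, a r) +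
          ∫⁻ r in Set.Ioc v s, a r := by
        rw [← lintegral_union measurableSet_Ioc, Set.Ioc_union_Ioc_eq_Ioc hv.1.le hv.2]
        exact Set.Ioc_disjoint_Ioc_of_le le_rfl
      rw [this, add_mul]
      congr 1
      · rw [mul_left_comm, ih v]; ring
      · ring
    rw [h1, lintegral_add_left (hp1.const_mul _), tri_swap a _ ha hp,
      lintegral_const_mul _ hp1]
    have : ∀ r, ∫⁻ v in Set.Ioc (0:ℝ) r, a v * itJ a n v = itJ a (n+1) r := fun r => rfl
    simp_rw [this]
    have : ∫⁻ v in Set.Ioc (0:ℝ) s, a v * itJ a (n+1) v = itJ a (n+2) s := rfl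
    rw [this]
    push_cast; ring

theorem itJ_eq (a : ℝ → ℝ≥0∞) (ha : Measurable a) (n : ℕ) (s : ℝ) :
    (n.factorial : ℝ≥0∞) * itJ a n s = (∫⁻ r in Set.Ioc (0:ℝ) s, a r) ^ n := by
  induction n with
  | zero => simp [itJ]
  | succ n ih =>
    rw [pow_succ, ← ih, mul_assoc, mul_comm (itJ a n s), itJ_mul a ha, Nat.factorial_succ]
    push_cast; ring

noncomputable def hn (a b : ℝ → ℝ≥0∞) (n : ℕ) (s t : ℝ) : ℝ≥0∞ :=
  ∑ ij ∈ Finset.HasAntidiagonal.antidiagonal n, (n.choose ij.1 : ℝ≥0∞) * (itJ a ij.1 s * itJ b ij.2 t)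

theorem hn_succ (a b : ℝ → ℝ≥0∞) (ha : Measurable a) (hb : Measurable b) (n : ℕ) (s t : ℝ) :
    (∫⁻ r in Set.Ioc (0:ℝ) s, a r * hn a b n r t) + (∫⁻ v in Set.Ioc (0:ℝ) t, b v * hn a b n s v)
      = hn a b (n+1) s t := by
  have h1 : (∫⁻ r in Set.Ioc (0:ℝ) s, a r * hn a b n r t) =
      ∑ ij ∈ Finset.HasAntidiagonal.antidiagonal n, (n.choose ij.1 : ℝ≥0∞) *
        (itJ a (ij.1+1) s * itJ b ij.2 t) := by
    simp_rw [hn, Finset.mul_sum]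
    rw [lintegral_finsetSum]
    · refine Finset.sum_congr rfl fun ij _ => ?_
      have : ∀ r, a r * ((n.choose ij.1 : ℝ≥0∞) * (itJ a ij.1 r * itJ b ij.2 t)) =
        ((n.choose ij.1 : ℝ≥0∞) * itJ b ij.2 t) * (a r * itJ a ij.1 r) := fun r => by ring
      simp_rw [this]
      have hp : Measurable (fun r => a r * itJ a ij.1 r) := ha.mul (measurable_itJ a _)
      rw [lintegral_const_mul _ hp]
      rw [show (∫⁻ r in Set.Ioc (0:ℝ) s, a r * itJ a ij.1 r) = itJ a (ij.1+1) s from rfl]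
      ring
    · intro ij _
      exact ha.mul (((measurable_itJ a _).mul_const _).const_mul _)
  have h2 : (∫⁻ v in Set.Ioc (0:ℝ) t, b v * hn a b n s v) =
      ∑ ij ∈ Finset.HasAntidiagonal.antidiagonal n, (n.choose ij.1 : ℝ≥0∞) *
        (itJ a ij.1 s * itJ b (ij.2+1) t) := by
    simp_rw [hn, Finset.mul_sum]
    rw [lintegral_finsetSum]
    · refine Finset.sum_congr rfl fun ij _ => ?_
      have : ∀ r, b r * ((n.choose ij.1 : ℝ≥0∞) * (itJ a ij.1 s * itJ b ij.2 r)) =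
        ((n.choose ij.1 : ℝ≥0∞) * itJ a ij.1 s) * (b r * itJ b ij.2 r) := fun r => by ring
      simp_rw [this]
      have hp : Measurable (fun r => b r * itJ b ij.2 r) := hb.mul (measurable_itJ b _)
      rw [lintegral_const_mul _ hp]
      rw [show (∫⁻ r in Set.Ioc (0:ℝ) t, b r * itJ b ij.2 r) = itJ b (ij.2+1) t from rfl]
      ring
    · intro ij _
      exact hb.mul (((measurable_itJ b _).const_mul _).const_mul _)
  rw [h1, h2, hn, Finset.sum_antidiagonal_choose_succ_mul
    (fun i j => itJ a i s * itJ b j t) n, add_comm]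
  congr 1
  refine Finset.sum_congr rfl fun ij hij => ?_
  rw [Nat.choose_symm_of_eq_add (Finset.HasAntidiagonal.mem_antidiagonal.1 hij).symm]

theorem measurable_hn_left (a b : ℝ → ℝ≥0∞) (n : ℕ) (t : ℝ) :
    Measurable (fun s => hn a b n s t) := by
  unfold hn
  exact Finset.measurable_fun_sum _ fun ij _ => (((measurable_itJ a _).mul_const _).const_mul _)

theorem measurable_hn_right (a b : ℝ → ℝ≥0∞) (n : ℕ) (s : ℝ) :
    Measurable (fun t => hn a b n s t) := by
  unfold hn
  exact Finset.measurable_fun_sum _ fun ij _ => (((measurable_itJ b _).const_mul _).const_mul _)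

theorem gron (a b : ℝ → ℝ≥0∞) (ha : Measurable a) (hb : Measurable b) (S T : ℝ)
    (G : ℝ → ℝ → ℝ≥0∞) (M K : ℝ≥0∞)
    (hK : ∀ s ∈ Set.Icc (0:ℝ) S, ∀ t ∈ Set.Icc (0:ℝ) T, G s t ≤ K)
    (hG : ∀ s ∈ Set.Icc (0:ℝ) S, ∀ t ∈ Set.Icc (0:ℝ) T,
      G s t ≤ M + (∫⁻ r in Set.Ioc (0:ℝ) s, a r * G r t) + ∫⁻ v in Set.Ioc (0:ℝ) t, b v * G s v)
    (n : ℕ) : ∀ s ∈ Set.Icc (0:ℝ) S, ∀ t ∈ Set.Icc (0:ℝ) T,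
      G s t ≤ M * (∑ m ∈ Finset.range n, hn a b m s t) + K * hn a b n s t := by
  induction n with
  | zero => intro s hs t ht; simpa [hn, itJ] using hK s hs t ht
  | succ n ih =>
    intro s hs t ht
    refine (hG s hs t ht).trans ?_
    have b1 : (∫⁻ r in Set.Ioc (0:ℝ) s, a r * G r t) ≤
        M * (∑ m ∈ Finset.range n, ∫⁻ r in Set.Ioc (0:ℝ) s, a r * hn a b m r t) +
          K * ∫⁻ r in Set.Ioc (0:ℝ) s, a r * hn a b n r t := by
      calc _ ≤ ∫⁻ r in Set.Ioc (0:ℝ) s, (M * (∑ m ∈ Finset.range n, a r * hn a b m r t) +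
          K * (a r * hn a b n r t)) := by
            refine setLIntegral_mono' measurableSet_Ioc fun r hr => ?_
            refine (mul_le_mul_right (ih r ⟨hr.1.le, hr.2.trans hs.2⟩ t ht) (a r)).trans
              (le_of_eq ?_)
            rw [← Finset.mul_sum]; ring
        _ = _ := by
          have hm : ∀ m, Measurable (fun r => a r * hn a b m r t) :=
            fun m => ha.mul (measurable_hn_left a b m t)
          rw [lintegral_add_right _ ((hm n).const_mul _), lintegral_const_mul _ (hm n),
            lintegral_const_mul _ (Finset.measurable_fun_sum _ fun m _ => hm m),
            lintegral_finsetSum _ fun m _ => hm m]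
    have b2 : (∫⁻ v in Set.Ioc (0:ℝ) t, b v * G s v) ≤
        M * (∑ m ∈ Finset.range n, ∫⁻ v in Set.Ioc (0:ℝ) t, b v * hn a b m s v) +
          K * ∫⁻ v in Set.Ioc (0:ℝ) t, b v * hn a b n s v := by
      calc _ ≤ ∫⁻ v in Set.Ioc (0:ℝ) t, (M * (∑ m ∈ Finset.range n, b v * hn a b m s v) +
          K * (b v * hn a b n s v)) := by
            refine setLIntegral_mono' measurableSet_Ioc fun r hr => ?_
            refine (mul_le_mul_right (ih s hs r ⟨hr.1.le, hr.2.trans ht.2⟩) (b r)).trans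
              (le_of_eq ?_)
            rw [← Finset.mul_sum]; ring
        _ = _ := by
          have hm : ∀ m, Measurable (fun r => b r * hn a b m s r) :=
            fun m => hb.mul (measurable_hn_right a b m s)
          rw [lintegral_add_right _ ((hm n).const_mul _), lintegral_const_mul _ (hm n),
            lintegral_const_mul _ (Finset.measurable_fun_sum _ fun m _ => hm m),
            lintegral_finsetSum _ fun m _ => hm m]
    refine (add_le_add (add_le_add_right b1 M) b2).trans (le_of_eq ?_)
    rw [Finset.sum_range_succ', ← hn_succ a b ha hb n s t]
    simp_rw [← hn_succ a b ha hb _ s t]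
    rw [Finset.sum_add_distrib]
    have : hn a b 0 s t = 1 := by simp [hn, itJ]
    rw [this]; ring

open scoped BigOperators ENNReal
open MeasureTheory

theorem tsum_antidiag (f : ℕ × ℕ → ℝ≥0∞) :
    ∑' n : ℕ, ∑ ij ∈ Finset.HasAntidiagonal.antidiagonal n, f ij = ∑' i : ℕ, ∑' j : ℕ, f (i, j) := by
  rw [← ENNReal.tsum_prod', ← (Finset.HasAntidiagonal.sigmaAntidiagonalEquivProd (A := ℕ)).tsum_eq f,
    ENNReal.tsum_sigma']
  congr 1; ext n
  rw [tsum_fintype, Finset.univ_eq_attach, ← Finset.sum_attach]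
  rfl

theorem choose_vdm (i j : ℕ) :
    (((i + j).choose i : ℕ) : ℝ≥0∞) = ∑' k : ℕ, (i.choose k : ℝ≥0∞) * (j.choose k : ℝ≥0∞) := by
  rw [Nat.add_choose_eq, tsum_eq_sum (s := Finset.range (i+1))]
  · rw [← Finset.Nat.sum_antidiagonal_swap,
      Finset.Nat.sum_antidiagonal_eq_sum_range_succ_mk]
    push_cast
    refine Finset.sum_congr rfl fun k hk => ?_
    simp only [Prod.fst_swap, Prod.snd_swap]
    rw [Nat.choose_symm (by simpa [Nat.lt_succ_iff] using hk)]
  · intro k hk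
    rw [Nat.choose_eq_zero_of_lt (by simpa using hk)]; simp

theorem tsum_exp (x : ℝ) (hx : 0 ≤ x) :
    ∑' i : ℕ, ENNReal.ofReal (x ^ i / i.factorial) = ENNReal.ofReal (Real.exp x) := by
  have h := NormedSpace.expSeries_div_hasSum_exp (𝔸 := ℝ) x
  rw [← Real.exp_eq_exp_ℝ] at h
  rw [← ENNReal.ofReal_tsum_of_nonneg (fun n => by positivity) h.summable, h.tsum_eq]

theorem tsum_choose (x : ℝ) (hx : 0 ≤ x) (k : ℕ) :
    ∑' i : ℕ, (i.choose k : ℝ≥0∞) * ENNReal.ofReal (x ^ i / i.factorial)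
      = ENNReal.ofReal (x ^ k / k.factorial * Real.exp x) := by
  rw [ENNReal.ofReal_mul (by positivity), ← tsum_exp x hx, ← ENNReal.tsum_mul_left]
  rw [← (add_left_injective k).tsum_eq]
  · congr 1; ext j
    rw [← ENNReal.ofReal_mul (by positivity), ← ENNReal.ofReal_natCast,
      ← ENNReal.ofReal_mul (by positivity)]
    congr 1
    have := Nat.add_choose_mul_factorial_mul_factorial j k
    have h : (((j + k).choose k : ℕ) : ℝ) * j.factorial * k.factorial = (j+k).factorial := by
      rw [← this]; push_cast; ring
    have h1 : ((j+k).factorial : ℝ) ≠ 0 := by positivity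
    have h2 : (j.factorial : ℝ) ≠ 0 := by positivity
    have h3 : (k.factorial : ℝ) ≠ 0 := by positivity
    field_simp
    rw [← h]; ring
  · intro i hi
    by_contra hc
    apply hi
    have : i < k := by
      by_contra h
      exact hc ⟨i - k, by simp; omega⟩
    simp [Nat.choose_eq_zero_of_lt this]

theorem bessel_series (x y : ℝ) (hx : 0 ≤ x) (hy : 0 ≤ y) :
    ∑' n : ℕ, ∑ ij ∈ Finset.HasAntidiagonal.antidiagonal n, (n.choose ij.1 : ℝ≥0∞) *
      (ENNReal.ofReal (x ^ ij.1 / ij.1.factorial) * ENNReal.ofReal (y ^ ij.2 / ij.2.factorial))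
    = ENNReal.ofReal (Real.exp (x + y) * besselI0 (2 * Real.sqrt (x * y))) := by
  have h1 : ∀ n : ℕ, ∑ ij ∈ Finset.HasAntidiagonal.antidiagonal n, (n.choose ij.1 : ℝ≥0∞) *
      (ENNReal.ofReal (x ^ ij.1 / ij.1.factorial) * ENNReal.ofReal (y ^ ij.2 / ij.2.factorial)) =
      ∑ ij ∈ Finset.HasAntidiagonal.antidiagonal n, ((ij.1 + ij.2).choose ij.1 : ℝ≥0∞) *
      (ENNReal.ofReal (x ^ ij.1 / ij.1.factorial) * ENNReal.ofReal (y ^ ij.2 / ij.2.factorial)) := by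
    intro n
    refine Finset.sum_congr rfl fun ij hij => ?_
    rw [Finset.HasAntidiagonal.mem_antidiagonal.1 hij]
  simp_rw [h1]
  rw [tsum_antidiag (fun ij => ((ij.1 + ij.2).choose ij.1 : ℝ≥0∞) *
      (ENNReal.ofReal (x ^ ij.1 / ij.1.factorial) * ENNReal.ofReal (y ^ ij.2 / ij.2.factorial)))]
  simp_rw [choose_vdm, ← ENNReal.tsum_mul_right]
  have h2 : ∀ i : ℕ, ∑' j : ℕ, ∑' k : ℕ, (i.choose k : ℝ≥0∞) * (j.choose k : ℝ≥0∞) *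
      (ENNReal.ofReal (x ^ i / i.factorial) * ENNReal.ofReal (y ^ j / j.factorial)) =
      ∑' k : ℕ, ((i.choose k : ℝ≥0∞) * ENNReal.ofReal (x ^ i / i.factorial)) *
        ENNReal.ofReal (y ^ k / k.factorial * Real.exp y) := by
    intro i
    rw [ENNReal.tsum_comm]
    congr 1; ext k
    rw [← tsum_choose y hy k, ← ENNReal.tsum_mul_left]
    congr 1; ext j; ring
  simp_rw [h2]
  rw [ENNReal.tsum_comm]
  simp_rw [ENNReal.tsum_mul_right, tsum_choose x hx]
  have h3 : ∀ k : ℕ, ENNReal.ofReal (x ^ k / k.factorial * Real.exp x) *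
      ENNReal.ofReal (y ^ k / k.factorial * Real.exp y) =
      ENNReal.ofReal (Real.exp (x+y)) *
        ENNReal.ofReal ((2 * Real.sqrt (x * y) / 2) ^ (2 * k) / (k.factorial : ℝ) ^ 2) := by
    intro k
    rw [← ENNReal.ofReal_mul (by positivity), ← ENNReal.ofReal_mul (by positivity)]
    congr 1
    rw [pow_mul, mul_div_cancel_left₀ _ (two_ne_zero), Real.sq_sqrt (by positivity),
      Real.exp_add, mul_pow]
    ring
  simp_rw [h3]
  rw [ENNReal.tsum_mul_left, ENNReal.ofReal_mul (by positivity), besselI0,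
    ENNReal.ofReal_tsum_of_nonneg (fun n => by positivity)]
  refine Summable.of_nonneg_of_le (fun n => by positivity) (fun k => ?_)
    (Real.summable_pow_div_factorial (x * y))
  rw [pow_mul, mul_div_cancel_left₀ _ (two_ne_zero), Real.sq_sqrt (by positivity)]
  gcongr
  have : (1:ℝ) ≤ k.factorial := by exact_mod_cast Nat.succ_le_of_lt k.factorial_pos
  nlinarith

theorem itJ_ofReal (a : ℝ → ℝ≥0∞) (ha : Measurable a) (n : ℕ) (s : ℝ)
    (hs : ∫⁻ r in Set.Ioc (0:ℝ) s, a r ≠ ⊤) :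
    itJ a n s = ENNReal.ofReal ((∫⁻ r in Set.Ioc (0:ℝ) s, a r).toReal ^ n / n.factorial) := by
  have h := itJ_eq a ha n s
  have h0 : (n.factorial : ℝ≥0∞) ≠ 0 := by exact_mod_cast n.factorial_ne_zero
  rw [ENNReal.ofReal_div_of_pos (by positivity), ENNReal.ofReal_pow (by positivity),
    ENNReal.ofReal_toReal hs, ENNReal.ofReal_natCast, ← h, mul_comm,
    ENNReal.mul_div_cancel_right h0 (by simp)]

theorem gron_final (a b : ℝ → ℝ≥0∞) (ha : Measurable a) (hb : Measurable b) (S T : ℝ)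
    (hS : 0 ≤ S) (hT : 0 ≤ T)
    (haf : ∫⁻ r in Set.Ioc (0:ℝ) S, a r ≠ ⊤) (hbf : ∫⁻ r in Set.Ioc (0:ℝ) T, b r ≠ ⊤)
    (G : ℝ → ℝ → ℝ≥0∞) (M K : ℝ≥0∞) (hKt : K ≠ ⊤)
    (hK : ∀ s ∈ Set.Icc (0:ℝ) S, ∀ t ∈ Set.Icc (0:ℝ) T, G s t ≤ K)
    (hG : ∀ s ∈ Set.Icc (0:ℝ) S, ∀ t ∈ Set.Icc (0:ℝ) T,
      G s t ≤ M + (∫⁻ r in Set.Ioc (0:ℝ) s, a r * G r t) + ∫⁻ v in Set.Ioc (0:ℝ) t, b v * G s v) :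
    G S T ≤ ENNReal.ofReal (Real.exp ((∫⁻ r in Set.Ioc (0:ℝ) S, a r).toReal +
      (∫⁻ r in Set.Ioc (0:ℝ) T, b r).toReal) * besselI0 (2 * Real.sqrt (
        (∫⁻ r in Set.Ioc (0:ℝ) S, a r).toReal * (∫⁻ r in Set.Ioc (0:ℝ) T, b r).toReal))) * M := by
  rw [← bessel_series _ _ ENNReal.toReal_nonneg ENNReal.toReal_nonneg]
  simp_rw [← itJ_ofReal a ha _ S haf, ← itJ_ofReal b hb _ T hbf]
  have hsum : ∑' n, hn a b n S T ≠ ⊤ := by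
    simp_rw [hn, itJ_ofReal a ha _ S haf, itJ_ofReal b hb _ T hbf]
    rw [bessel_series _ _ ENNReal.toReal_nonneg ENNReal.toReal_nonneg]
    simp
  have h0 : Filter.Tendsto (fun n => hn a b n S T) Filter.atTop (nhds 0) :=
    ENNReal.tendsto_atTop_zero_of_tsum_ne_top hsum
  have h1 : Filter.Tendsto (fun n => M * (∑' n, hn a b n S T) + K * hn a b n S T) Filter.atTop
      (nhds (M * (∑' n, hn a b n S T) + K * 0)) :=
    tendsto_const_nhds.add (ENNReal.Tendsto.const_mul h0 (Or.inr hKt))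
  rw [mul_zero, add_zero] at h1
  rw [mul_comm]
  refine ge_of_tendsto' h1 fun n => ?_
  refine (gron a b ha hb S T G M K hK hG n S ⟨hS, le_rfl⟩ T ⟨hT, le_rfl⟩).trans ?_
  gcongr
  exact ENNReal.sum_le_tsum _

open scoped BigOperators ENNReal
open MeasureTheory

namespace TS
variable {d : ℕ}

noncomputable def vec (n : ℕ) (f : Word d n → ℝ) : EuclideanSpace ℝ (Word d n) := WithLp.toLp 2 f

/-- extended level norm -/
noncomputable def L (x : TS d) (n : ℕ) : ℝ≥0∞ := ENNReal.ofReal (levelNorm x n)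

theorem norm_vec (n : ℕ) (f : Word d n → ℝ) : ‖vec n f‖ = Real.sqrt (∑ w, f w ^ 2) := by
  rw [EuclideanSpace.norm_eq]
  simp [vec]

theorem L_eq (x : TS d) (n : ℕ) : L x n = ‖vec n (x n)‖ₑ := by
  rw [← ofReal_norm, norm_vec]; rfl

theorem L_ne_top (x : TS d) (n : ℕ) : L x n ≠ ⊤ := ENNReal.ofReal_ne_top

theorem N_eq (x : TS d) : pNorm 1 x = ∑' n, L x n := by
  simp [pNorm, L]

theorem L_le_N (x : TS d) (n : ℕ) : L x n ≤ pNorm 1 x := by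
  rw [N_eq]; exact ENNReal.le_tsum n

theorem comp_le_L (x : TS d) (n : ℕ) (w : Word d n) : ‖x n w‖ₑ ≤ L x n := by
  rw [L_eq]
  rw [enorm_le_iff_norm_le]
  exact PiLp.norm_apply_le (vec n (x n)) w

theorem L_add (x y : TS d) (n : ℕ) : L (add x y) n ≤ L x n + L y n := by
  simp_rw [L_eq]
  exact enorm_add_le (vec n (x n)) (vec n (y n))

theorem L_smul (c : ℝ) (x : TS d) (n : ℕ) : L (smul c x) n = ‖c‖ₑ * L x n := by
  simp_rw [L_eq]
  rw [← enorm_smul]; rfl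

theorem L_reduce (x : TS d) (n : ℕ) : L (reduce x) n = if n = 0 then 0 else L x n := by
  by_cases h : n = 0
  · simp [h, L, levelNorm, reduce]
  · simp [h, L, levelNorm, reduce]

theorem N_tri (x y : TS d) : pNorm 1 x ≤ pNorm 1 (sub x y) + pNorm 1 y := by
  simp_rw [N_eq]
  rw [← ENNReal.tsum_add]
  refine ENNReal.tsum_le_tsum fun n => ?_
  refine le_trans (le_of_eq ?_) (L_add (sub x y) y n)
  congr 1; ext n w; simp [add, sub]

theorem N_add (x y : TS d) : pNorm 1 (add x y) ≤ pNorm 1 x + pNorm 1 y := by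
  simp_rw [N_eq]
  rw [← ENNReal.tsum_add]
  exact ENNReal.tsum_le_tsum fun n => L_add x y n

theorem sum_le_L (x y : TS d) (n : ℕ) : ‖∑ w : Word d n, x n w * y n w‖ₑ ≤ L x n * L y n := by
  simp_rw [L_eq]
  rw [← ofReal_norm, ← ofReal_norm, ← ofReal_norm, ← ENNReal.ofReal_mul (norm_nonneg _)]
  apply ENNReal.ofReal_le_ofReal
  have := abs_real_inner_le_norm (vec n (x n)) (vec n (y n))
  simpa [vec, PiLp.inner_apply, mul_comm] using this

theorem summable_of_le {f : ℕ → ℝ} {g : ℕ → ℝ≥0∞} (h : ∀ n, ‖f n‖ₑ ≤ g n) (hg : ∑' n, g n ≠ ⊤) :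
    Summable f := by
  apply Summable.of_norm
  rw [← tsum_enorm_ne_top_iff_summable_norm]
  exact ne_top_of_le_ne_top hg (ENNReal.tsum_le_tsum h)

theorem tsum_LL_le (x y : TS d) : ∑' n, L x n * L y n ≤ pNorm 1 x * pNorm 1 y := by
  calc _ ≤ ∑' n, L x n * pNorm 1 y := ENNReal.tsum_le_tsum fun n => by gcongr; exact L_le_N y n
    _ = _ := by rw [ENNReal.tsum_mul_right, ← N_eq]

theorem pairing_summable (x y : TS d) (hx : pNorm 1 x ≠ ⊤) (hy : pNorm 1 y ≠ ⊤) :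
    Summable (fun n => ∑ w : Word d n, x n w * y n w) :=
  summable_of_le (sum_le_L x y) (ne_top_of_le_ne_top (ENNReal.mul_ne_top hx hy) (tsum_LL_le x y))

theorem pairing_le (x y : TS d) : ‖pairing x y‖ₑ ≤ ∑' n, L x n * L y n :=
  enorm_tsum_le_tsum_enorm.trans (ENNReal.tsum_le_tsum fun n => sum_le_L x y n)

theorem pairing_add (a x y : TS d) (ha : pNorm 1 a ≠ ⊤) (hx : pNorm 1 x ≠ ⊤) (hy : pNorm 1 y ≠ ⊤) :
    pairing a (add x y) = pairing a x + pairing a y := by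
  unfold pairing
  rw [← (pairing_summable a x ha hx).tsum_add (pairing_summable a y ha hy)]
  congr 1; ext n
  rw [← Finset.sum_add_distrib]
  refine Finset.sum_congr rfl fun w _ => ?_
  simp [add, mul_add]

theorem pairing_smul (c : ℝ) (a x : TS d) :
    pairing a (smul c x) = c * pairing a x := by
  unfold pairing
  rw [← tsum_mul_left]
  congr 1; ext n
  rw [Finset.mul_sum]
  refine Finset.sum_congr rfl fun w _ => ?_
  simp [smul]; ring

theorem pairing_reduce (a x : TS d) (ha : ∀ w, a 0 w = 0) :
    pairing a (reduce x) = pairing a x := by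
  unfold pairing
  congr 1; ext n
  refine Finset.sum_congr rfl fun w _ => ?_
  by_cases h : n = 0
  · subst h; simp [ha]
  · simp [reduce, h]

theorem sum_split {n k j : ℕ} (h : n = k + j) (f : Word d n → ℝ) :
    ∑ w, f w = ∑ v : Word d k, ∑ v' : Word d j, f (fun i => Fin.append v v' (Fin.cast h i)) := by
  subst h
  rw [← Fintype.sum_prod_type', ← (Fin.appendEquiv k j).sum_comp]
  rfl

theorem cast_app {n k j : ℕ} (h : n = k + j) (y : TS d) (w : Word d (k + j)) :
    y n (fun i => w (Fin.cast h i)) = y (k + j) w := by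
  subst h; rfl

theorem app_left {n k j : ℕ} (h : n = k + j) (v : Word d k) (v' : Word d j)
    (p : ∀ i : Fin k, i.1 < n) :
    (fun i : Fin k => Fin.append v v' (Fin.cast h ⟨i.1, p i⟩)) = v := by
  funext i
  exact Fin.append_left v v' i

theorem app_right {n k j : ℕ} (h : n = k + j) (v : Word d k) (v' : Word d j)
    (p : ∀ i : Fin j, k + i.1 < n) :
    (fun i : Fin j => Fin.append v v' (Fin.cast h ⟨k + i.1, p i⟩)) = v' := by
  funext i
  exact Fin.append_right v v' i

theorem norm_mul_piece (x y : TS d) (n : ℕ) (k : Fin (n+1)) :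
    ‖vec n (fun w => x k.1 (fun i => w ⟨i.1, by have h1 := i.2; have h2 := k.2; omega⟩) *
      y (n - k.1) (fun i => w ⟨k.1 + i.1, by have h1 := i.2; have h2 := k.2; omega⟩))‖ₑ
      ≤ L x k.1 * L y (n - k.1) := by
  rw [L_eq, L_eq, ← ofReal_norm, ← ofReal_norm, ← ofReal_norm, ← ENNReal.ofReal_mul (norm_nonneg _)]
  apply ENNReal.ofReal_le_ofReal
  rw [norm_vec, norm_vec, norm_vec, ← Real.sqrt_mul (Finset.sum_nonneg fun _ _ => sq_nonneg _)]
  apply Real.sqrt_le_sqrt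
  have h : n = k.1 + (n - k.1) := by have := k.2; omega
  rw [sum_split h]
  simp_rw [app_left h, app_right h]
  rw [Finset.sum_mul_sum]
  apply le_of_eq
  refine Finset.sum_congr rfl fun v _ => Finset.sum_congr rfl fun v' _ => by ring

theorem L_mul (x y : TS d) (n : ℕ) :
    L (mul x y) n ≤ ∑ k : Fin (n+1), L x k.1 * L y (n - k.1) := by
  rw [L_eq]
  have : vec n (mul x y n) = ∑ k : Fin (n+1), vec n (fun w => x k.1 (fun i => w ⟨i.1, by have h1 := i.2; have h2 := k.2; omega⟩) *
      y (n - k.1) (fun i => w ⟨k.1 + i.1, by have h1 := i.2; have h2 := k.2; omega⟩)) := by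
    ext w
    simp [vec, mul]
  rw [this]
  refine (enorm_sum_le _ _).trans (Finset.sum_le_sum fun k _ => norm_mul_piece x y n k)

theorem fin_antidiag {β : Type*} [AddCommMonoid β] (f : ℕ → ℕ → β) (n : ℕ) :
    ∑ k : Fin (n+1), f k.1 (n - k.1) = ∑ ij ∈ Finset.HasAntidiagonal.antidiagonal n, f ij.1 ij.2 := by
  rw [Finset.Nat.sum_antidiagonal_eq_sum_range_succ f, Finset.sum_range (fun k => f k (n - k))]

theorem N_mul (x y : TS d) : pNorm 1 (mul x y) ≤ pNorm 1 x * pNorm 1 y := by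
  rw [N_eq (mul x y)]
  refine (ENNReal.tsum_le_tsum fun n => L_mul x y n).trans ?_
  simp_rw [fin_antidiag (fun i j => L x i * L y j)]
  rw [tsum_antidiag (fun ij => L x ij.1 * L y ij.2)]
  simp_rw [ENNReal.tsum_mul_left, ENNReal.tsum_mul_right, ← N_eq]
  exact le_rfl

theorem norm_adj_piece (x z : TS d) (n k : ℕ) :
    ‖vec n (fun w => ∑ v : Word d k, x k v * z (k + n) (Fin.append v w))‖ₑ
      ≤ L x k * L z (k + n) := by
  rw [L_eq, L_eq, ← ofReal_norm, ← ofReal_norm, ← ofReal_norm, ← ENNReal.ofReal_mul (norm_nonneg _)]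
  apply ENNReal.ofReal_le_ofReal
  rw [norm_vec, norm_vec, norm_vec, ← Real.sqrt_mul (Finset.sum_nonneg fun _ _ => sq_nonneg _)]
  apply Real.sqrt_le_sqrt
  rw [sum_split (rfl : k + n = k + n)]
  rw [Finset.sum_comm (s := (Finset.univ : Finset (Word d k))), Finset.mul_sum]
  refine Finset.sum_le_sum fun w _ => ?_
  exact Finset.sum_mul_sq_le_sq_mul_sq _ _ _

theorem L_adjL (x z : TS d) (n : ℕ) :
    L (adjL x z) n ≤ ∑' k, L x k * L z (k + n) := by
  by_cases ht : ∑' k, L x k * L z (k + n) = ⊤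
  · rw [ht]; exact le_top
  have hs : Summable (fun k => vec n (fun w => ∑ v : Word d k, x k v * z (k + n) (Fin.append v w))) := by
    apply Summable.of_norm
    rw [← tsum_enorm_ne_top_iff_summable_norm]
    exact ne_top_of_le_ne_top ht (ENNReal.tsum_le_tsum fun k => norm_adj_piece x z n k)
  have : vec n (adjL x z n) =
      ∑' k, vec n (fun w => ∑ v : Word d k, x k v * z (k + n) (Fin.append v w)) := by
    ext w
    have := (EuclideanSpace.proj w : EuclideanSpace ℝ (Word d n) →L[ℝ] ℝ).map_tsum hs
    exact this.symm
  rw [L_eq, this]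
  exact enorm_tsum_le_tsum_enorm.trans (ENNReal.tsum_le_tsum fun k => norm_adj_piece x z n k)

theorem adjL_summable (x z : TS d) (hx : pNorm 1 x ≠ ⊤) (hz : pNorm 1 z ≠ ⊤) (n : ℕ) (w : Word d n) :
    Summable (fun k => ∑ v : Word d k, x k v * z (k + n) (Fin.append v w)) := by
  refine summable_of_le (g := fun k => L x k * L z (k + n)) (fun k => ?_) ?_
  · refine le_trans ?_ (norm_adj_piece x z n k)
    rw [enorm_le_iff_norm_le]
    exact PiLp.norm_apply_le (vec n (fun w => ∑ v : Word d k, x k v * z (k + n) (Fin.append v w))) w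
  · refine ne_top_of_le_ne_top (ENNReal.mul_ne_top hx hz) ?_
    rw [N_eq x, ← ENNReal.tsum_mul_right]
    exact ENNReal.tsum_le_tsum fun k => by gcongr; exact L_le_N _ _

theorem tsum_shift_le (z : TS d) (k : ℕ) : ∑' n, L z (k + n) ≤ pNorm 1 z := by
  rw [N_eq]
  exact ENNReal.tsum_comp_le_tsum_of_injective (add_right_injective k) (L z)

theorem adj_total (x z : TS d) : ∑' n, ∑' k, L x k * L z (k + n) ≤ pNorm 1 x * pNorm 1 z := by
  rw [ENNReal.tsum_comm]
  simp_rw [ENNReal.tsum_mul_left]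
  rw [N_eq x, ← ENNReal.tsum_mul_right]
  exact ENNReal.tsum_le_tsum fun k => by gcongr; exact tsum_shift_le _ _

theorem N_adjL (x z : TS d) : pNorm 1 (adjL x z) ≤ pNorm 1 x * pNorm 1 z := by
  rw [N_eq (adjL x z)]
  exact (ENNReal.tsum_le_tsum fun n => L_adjL x z n).trans (adj_total x z)

/-- the driving field -/
noncomputable def fld (u : ℝ) (φ ψ y : TS d) : TS d :=
  add (add (smul u y) (mul φ y)) (reduce (adjL ψ y))

theorem fld_bound (u : ℝ) (φ ψ y : TS d) :
    ‖pairing y ψ‖ₑ + pNorm 1 (fld u φ ψ y) ≤ pNorm 1 y * (‖u‖ₑ + pNorm 1 φ + pNorm 1 ψ) := by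
  have h1 : pNorm 1 (smul u y) = ‖u‖ₑ * pNorm 1 y := by
    simp_rw [N_eq, L_smul, ENNReal.tsum_mul_left]
  have h2 : ‖pairing y ψ‖ₑ + pNorm 1 (reduce (adjL ψ y)) ≤ pNorm 1 ψ * pNorm 1 y := by
    refine le_trans ?_ (adj_total ψ y)
    rw [N_eq, tsum_eq_zero_add' ENNReal.summable, tsum_eq_zero_add' (f := fun n => ∑' k, L ψ k * L y (k + n)) ENNReal.summable]
    simp only [L_reduce, if_true, zero_add]
    refine add_le_add ?_ (ENNReal.tsum_le_tsum fun n => ?_)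
    · refine (pairing_le y ψ).trans (le_of_eq ?_)
      congr 1; ext k; simp [mul_comm]
    · simpa using L_adjL ψ y (n+1)
  calc _ ≤ ‖pairing y ψ‖ₑ + (pNorm 1 (smul u y) + pNorm 1 (mul φ y) + pNorm 1 (reduce (adjL ψ y))) := by
        gcongr
        exact (N_add _ _).trans (by gcongr; exact N_add _ _)
    _ = pNorm 1 (smul u y) + pNorm 1 (mul φ y) + (‖pairing y ψ‖ₑ + pNorm 1 (reduce (adjL ψ y))) := by ring
    _ ≤ ‖u‖ₑ * pNorm 1 y + pNorm 1 φ * pNorm 1 y + pNorm 1 ψ * pNorm 1 y := by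
        rw [h1]; gcongr; exact N_mul _ _
    _ = _ := by ring

/-- triple form -/
noncomputable def tri (x z y : TS d) (k j : ℕ) : ℝ :=
  ∑ v : Word d k, ∑ v' : Word d j, x k v * z j v' * y (k + j) (Fin.append v v')

theorem tri_le (x z y : TS d) (k j : ℕ) : ‖tri x z y k j‖ₑ ≤ L x k * L z j * L y (k + j) := by
  obtain ⟨q, hq⟩ : ∃ q : TS d, q = fun (n : ℕ) (w : Word d n) =>
    ∑ v : Word d k, x k v * y (k + n) (Fin.append v w) := ⟨_, rfl⟩
  have : tri x z y k j = ∑ v' : Word d j, z j v' * q j v' := by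
    rw [tri, Finset.sum_comm, hq]
    refine Finset.sum_congr rfl fun v' _ => ?_
    rw [Finset.mul_sum]
    refine Finset.sum_congr rfl fun v _ => by ring
  have h2 : L q j ≤ L x k * L y (k + j) := by
    rw [L_eq q, hq]
    exact norm_adj_piece x y j k
  rw [this]
  calc _ ≤ L z j * L q j := sum_le_L z q j
    _ ≤ L z j * (L x k * L y (k + j)) := by gcongr
    _ = _ := by ring

theorem tri_summable (x z y : TS d) (hx : pNorm 1 x ≠ ⊤) (hz : pNorm 1 z ≠ ⊤) (hy : pNorm 1 y ≠ ⊤) :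
    Summable (fun p : ℕ × ℕ => tri x z y p.1 p.2) := by
  apply Summable.of_norm
  rw [← tsum_enorm_ne_top_iff_summable_norm]
  refine ne_top_of_le_ne_top (ENNReal.mul_ne_top (ENNReal.mul_ne_top hx hz) hy) ?_
  rw [ENNReal.tsum_prod']
  calc _ ≤ ∑' k, ∑' j, L x k * L z j * pNorm 1 y :=
        ENNReal.tsum_le_tsum fun k => ENNReal.tsum_le_tsum fun j =>
          (tri_le x z y k j).trans (by gcongr; exact L_le_N _ _)
    _ = _ := by
      simp_rw [ENNReal.tsum_mul_right, ENNReal.tsum_mul_left, ENNReal.tsum_mul_right, ← N_eq]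

theorem adjR_summable (x z : TS d) (hx : pNorm 1 x ≠ ⊤) (hz : pNorm 1 z ≠ ⊤) (n : ℕ) (w : Word d n) :
    Summable (fun k => ∑ v : Word d k, x k v * z (n + k) (Fin.append w v)) := by
  refine summable_of_le (g := fun k => L x k * L z (n + k)) (fun k => ?_) ?_
  · refine (sum_le_L x (fun m v => z (n + m) (Fin.append w v)) k).trans ?_
    gcongr
    apply ENNReal.ofReal_le_ofReal
    apply Real.sqrt_le_sqrt
    rw [sum_split (rfl : n + k = n + k)]
    exact Finset.single_le_sum (f := fun v => ∑ v', z (n+k) (Fin.append v v') ^ 2)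
      (fun v _ => Finset.sum_nonneg fun _ _ => sq_nonneg _) (Finset.mem_univ w)
  · refine ne_top_of_le_ne_top (ENNReal.mul_ne_top hx hz) ?_
    rw [N_eq x, ← ENNReal.tsum_mul_right]
    exact ENNReal.tsum_le_tsum fun k => by gcongr; exact L_le_N _ _

theorem pairing_adjR (x z y : TS d) (hz : pNorm 1 z ≠ ⊤) (hy : pNorm 1 y ≠ ⊤) :
    pairing x (adjR z y) = ∑' k, ∑' j, tri x z y k j := by
  unfold pairing
  congr 1; ext k
  simp_rw [adjR, ← tsum_mul_left]
  rw [← Summable.tsum_finsetSum]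
  · congr 1; ext j
    rw [tri]
    refine Finset.sum_congr rfl fun v _ => ?_
    rw [Finset.mul_sum]
    refine Finset.sum_congr rfl fun v' _ => by ring
  · intro v _
    exact (adjR_summable z y hz hy k v).mul_left _

theorem pairing_adjL (x z y : TS d) (hx : pNorm 1 x ≠ ⊤) (hy : pNorm 1 y ≠ ⊤) :
    pairing z (adjL x y) = ∑' j, ∑' k, tri x z y k j := by
  unfold pairing
  congr 1; ext j
  simp_rw [adjL, ← tsum_mul_left]
  rw [← Summable.tsum_finsetSum]
  · congr 1; ext k
    rw [tri, Finset.sum_comm]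
    refine Finset.sum_congr rfl fun v _ => ?_
    rw [Finset.mul_sum]
    refine Finset.sum_congr rfl fun v' _ => by ring
  · intro v _
    exact (adjL_summable x y hx hy j v).mul_left _

theorem pairing_mul (x z y : TS d) :
    pairing y (mul x z) = ∑' n, ∑ ij ∈ Finset.HasAntidiagonal.antidiagonal n, tri x z y ij.1 ij.2 := by
  unfold pairing
  congr 1; ext n
  rw [← fin_antidiag (fun i j => tri x z y i j)]
  simp_rw [mul, Finset.mul_sum]
  rw [Finset.sum_comm]
  refine Finset.sum_congr rfl fun k _ => ?_
  have h : n = k.1 + (n - k.1) := by have := k.2; omega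
  rw [sum_split h]
  simp_rw [app_left h, app_right h, cast_app h]
  rw [tri]
  refine Finset.sum_congr rfl fun v _ => Finset.sum_congr rfl fun v' _ => by ring

theorem adj1 (x z y : TS d) (hx : pNorm 1 x ≠ ⊤) (hz : pNorm 1 z ≠ ⊤) (hy : pNorm 1 y ≠ ⊤) :
    pairing z (adjL x y) = pairing x (adjR z y) := by
  rw [pairing_adjL x z y hx hy, pairing_adjR x z y hz hy]
  have := tri_summable x z y hx hz hy
  exact Summable.tsum_comm (f := fun k j => tri x z y k j) this

theorem adj2 (x z y : TS d) (hx : pNorm 1 x ≠ ⊤) (hz : pNorm 1 z ≠ ⊤) (hy : pNorm 1 y ≠ ⊤) :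
    pairing y (mul x z) = pairing x (adjR z y) := by
  rw [pairing_mul x z y, pairing_adjR x z y hz hy]
  have := tri_summable x z y hx hz hy
  rw [← this.tsum_prod (f := fun p : ℕ × ℕ => tri x z y p.1 p.2), ← (Finset.HasAntidiagonal.sigmaAntidiagonalEquivProd (A := ℕ)).tsum_eq]
  have hs := (Finset.HasAntidiagonal.sigmaAntidiagonalEquivProd (A := ℕ)).summable_iff.2 this
  refine Eq.trans ?_ (Summable.tsum_sigma hs).symm
  congr 1; ext n
  rw [tsum_fintype, Finset.univ_eq_attach, ← Finset.sum_attach]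
  rfl

theorem pairing_fld (u : ℝ) (φ ψ y a : TS d) (hφ : pNorm 1 φ ≠ ⊤) (hψ : pNorm 1 ψ ≠ ⊤)
    (hy : pNorm 1 y ≠ ⊤) (ha : pNorm 1 a ≠ ⊤) (ha0 : ∀ w, a 0 w = 0)
    (hφ0 : ∀ w, φ 0 w = 0) (hψ0 : ∀ w, ψ 0 w = 0) :
    pairing a (fld u φ ψ y) = u * pairing a y + pairing ψ (reduce (adjR a y))
      + pairing φ (reduce (adjR y a)) := by
  have h1 : pNorm 1 (smul u y) ≠ ⊤ := by
    simp_rw [N_eq, L_smul, ENNReal.tsum_mul_left, ← N_eq]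
    exact ENNReal.mul_ne_top (by simp) hy
  have h2 : pNorm 1 (mul φ y) ≠ ⊤ := ne_top_of_le_ne_top (ENNReal.mul_ne_top hφ hy) (N_mul _ _)
  have h3 : pNorm 1 (add (smul u y) (mul φ y)) ≠ ⊤ :=
    ne_top_of_le_ne_top (ENNReal.add_ne_top.2 ⟨h1, h2⟩) (N_add _ _)
  have h4 : pNorm 1 (reduce (adjL ψ y)) ≠ ⊤ := by
    refine ne_top_of_le_ne_top (ENNReal.mul_ne_top hψ hy) (le_trans ?_ (N_adjL ψ y))
    simp_rw [N_eq, L_reduce]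
    exact ENNReal.tsum_le_tsum fun n => by split_ifs <;> simp
  rw [fld, pairing_add _ _ _ ha h3 h4, pairing_add _ _ _ ha h1 h2, pairing_smul,
    pairing_reduce a _ ha0, pairing_reduce ψ _ hψ0, pairing_reduce φ _ hφ0, adj1 ψ a y hψ ha hy,
    adj2 φ y a hφ hy ha]
  ring

end TS

open scoped BigOperators ENNReal
open MeasureTheory

namespace TS
variable {d : ℕ}

section gen
variable {μ : Measure ℝ} {F : ℝ → TS d}

theorem comp_integrable (hF : ∀ n w, AEMeasurable (fun r => F r n w) μ)
    (hfin : ∫⁻ r, pNorm 1 (F r) ∂μ ≠ ⊤) (n : ℕ) (w : Word d n) :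
    Integrable (fun r => F r n w) μ := by
  refine ⟨(hF n w).aestronglyMeasurable, ?_⟩
  refine lt_of_le_of_lt (lintegral_mono fun r => ?_) hfin.lt_top
  exact (comp_le_L (F r) n w).trans (L_le_N _ _)

theorem tsum_lintegral_le (g : ℕ → ℝ → ℝ≥0∞) :
    ∑' n, ∫⁻ r, g n r ∂μ ≤ ∫⁻ r, ∑' n, g n r ∂μ := by
  rw [ENNReal.tsum_eq_iSup_sum]
  refine iSup_le fun s => ?_
  have : ∑ n ∈ s, ∫⁻ r, g n r ∂μ ≤ ∫⁻ r, ∑ n ∈ s, g n r ∂μ := by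
    induction s using Finset.cons_induction with
    | empty => simp
    | cons a s h ih =>
      simp_rw [Finset.sum_cons]
      exact (add_le_add_right ih _).trans (le_lintegral_add _ _)
  exact this.trans (lintegral_mono fun r => ENNReal.sum_le_tsum s)

theorem L_self (x : TS d) (n : ℕ) : ‖∑ w : Word d n, x n w * x n w‖ₑ = L x n * L x n := by
  have h : ∑ w : Word d n, x n w * x n w = levelNorm x n * levelNorm x n := by
    rw [levelNorm, Real.mul_self_sqrt (Finset.sum_nonneg fun _ _ => sq_nonneg _)]
    exact Finset.sum_congr rfl fun w _ => by ring
  rw [h, enorm_mul, L, Real.enorm_of_nonneg (show 0 ≤ levelNorm x n from Real.sqrt_nonneg _)]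

theorem sum_integral (hF : ∀ n w, AEMeasurable (fun r => F r n w) μ)
    (hfin : ∫⁻ r, pNorm 1 (F r) ∂μ ≠ ⊤) (Φ : TS d)
    (hΦ : ∀ n w, Φ n w = ∫ r, F r n w ∂μ) (a : TS d) (n : ℕ) :
    ∑ w : Word d n, a n w * Φ n w = ∫ r, ∑ w : Word d n, a n w * F r n w ∂μ := by
  rw [integral_finsetSum]
  · refine Finset.sum_congr rfl fun w _ => ?_
    rw [integral_const_mul, hΦ]
  · intro w _
    exact (comp_integrable hF hfin n w).const_mul _

theorem L_integral (hF : ∀ n w, AEMeasurable (fun r => F r n w) μ)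
    (hfin : ∫⁻ r, pNorm 1 (F r) ∂μ ≠ ⊤) (Φ : TS d)
    (hΦ : ∀ n w, Φ n w = ∫ r, F r n w ∂μ) (n : ℕ) :
    L Φ n ≤ ∫⁻ r, L (F r) n ∂μ := by
  by_cases h0 : L Φ n = 0
  · rw [h0]; exact bot_le
  rw [← ENNReal.mul_le_mul_iff_right h0 (L_ne_top Φ n), ← L_self, sum_integral hF hfin Φ hΦ Φ n]
  refine (enorm_integral_le_lintegral_enorm _).trans ?_
  rw [← lintegral_const_mul' _ _ (L_ne_top Φ n)]
  exact lintegral_mono fun r => sum_le_L Φ (F r) n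

theorem N_integral (hF : ∀ n w, AEMeasurable (fun r => F r n w) μ)
    (hfin : ∫⁻ r, pNorm 1 (F r) ∂μ ≠ ⊤) (Φ : TS d)
    (hΦ : ∀ n w, Φ n w = ∫ r, F r n w ∂μ) :
    pNorm 1 Φ ≤ ∫⁻ r, pNorm 1 (F r) ∂μ := by
  simp_rw [N_eq]
  exact (ENNReal.tsum_le_tsum fun n => L_integral hF hfin Φ hΦ n).trans (tsum_lintegral_le _)

theorem pairing_integral (hF : ∀ n w, AEMeasurable (fun r => F r n w) μ)
    (hfin : ∫⁻ r, pNorm 1 (F r) ∂μ ≠ ⊤) (Φ : TS d)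
    (hΦ : ∀ n w, Φ n w = ∫ r, F r n w ∂μ) (a : TS d) (ha : pNorm 1 a ≠ ⊤) :
    pairing a Φ = ∫ r, pairing a (F r) ∂μ := by
  unfold pairing
  rw [integral_tsum]
  · congr 1; ext n
    exact sum_integral hF hfin Φ hΦ a n
  · intro n
    apply AEMeasurable.aestronglyMeasurable
    exact Finset.aemeasurable_fun_sum _ fun w _ => (hF n w).const_mul _
  · refine ne_top_of_le_ne_top ?_ (tsum_lintegral_le _)
    refine ne_top_of_le_ne_top (ENNReal.mul_ne_top ha hfin) ?_
    rw [← lintegral_const_mul' _ _ ha]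
    refine lintegral_mono fun r => ?_
    exact (ENNReal.tsum_le_tsum fun n => sum_le_L a (F r) n).trans (tsum_LL_le a (F r))

end gen

theorem measurable_N (y : ℝ → TS d) (hy : ∀ n w, Measurable fun u => y u n w) :
    Measurable (fun r => pNorm 1 (y r)) := by
  simp_rw [N_eq]
  refine Measurable.tsum fun n => ?_
  unfold L levelNorm
  refine ENNReal.measurable_ofReal.comp (Measurable.sqrt ?_)
  exact Finset.measurable_fun_sum _ fun w _ => (hy n w).pow_const 2

theorem fld_meas {μ : Measure ℝ} (u : ℝ → ℝ) (φ ψ y : ℝ → TS d) (hu : AEMeasurable u μ)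
    (hφ : ∀ n w, AEMeasurable (fun r => φ r n w) μ)
    (hψ : ∀ n w, AEMeasurable (fun r => ψ r n w) μ)
    (hy : ∀ n w, AEMeasurable (fun r => y r n w) μ)
    (hψf : ∀ᵐ r ∂μ, pNorm 1 (ψ r) ≠ ⊤) (hyf : ∀ᵐ r ∂μ, pNorm 1 (y r) ≠ ⊤) (n : ℕ) (w : Word d n) :
    AEMeasurable (fun r => fld (u r) (φ r) (ψ r) (y r) n w) μ := by
  simp only [fld, add, smul, mul, reduce]
  refine AEMeasurable.add (AEMeasurable.add (hu.mul (hy n w)) ?_) ?_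
  · exact Finset.aemeasurable_fun_sum _ fun k _ => (hφ _ _).mul (hy _ _)
  · by_cases h : n = 0
    · simp [h]
    · simp only [h, if_false]
      refine aemeasurable_of_tendsto_metrizable_ae Filter.atTop
        (f := fun N r => ∑ k ∈ Finset.range N, ∑ v : Word d k, ψ r k v * y r (k + n) (Fin.append v w))
        (fun N => Finset.aemeasurable_fun_sum _ fun k _ => Finset.aemeasurable_fun_sum _ fun v _ =>
          (hψ _ _).mul (hy _ _)) ?_
      filter_upwards [hψf, hyf] with r h1 h2
      exact (adjL_summable (ψ r) (y r) h1 h2 n w).hasSum.tendsto_sum_nat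

theorem fld_fin {μ : Measure ℝ} (u : ℝ → ℝ) (φ ψ y : ℝ → TS d) (K : ℝ≥0∞) (hK : K ≠ ⊤)
    (hb : ∀ᵐ r ∂μ, ‖u r‖ₑ + pNorm 1 (φ r) + pNorm 1 (ψ r) ≤ K)
    (hyf : ∫⁻ r, pNorm 1 (y r) ∂μ ≠ ⊤) :
    ∫⁻ r, pNorm 1 (fld (u r) (φ r) (ψ r) (y r)) ∂μ ≠ ⊤ := by
  refine ne_top_of_le_ne_top (ENNReal.mul_ne_top hyf hK) ?_
  rw [← lintegral_mul_const' _ _ hK]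
  refine lintegral_mono_ae ?_
  filter_upwards [hb] with r h
  refine le_trans (le_trans le_add_self (fld_bound _ _ _ _)) ?_
  gcongr

theorem comp_cont {F : ℝ → ℝ → TS d} {A : Set (ℝ × ℝ)} (h : Cont1On F A) (n : ℕ) (w : Word d n) :
    ContinuousOn (fun p : ℝ × ℝ => F p.1 p.2 n w) A := by
  rw [Metric.continuousOn_iff]
  intro p hp ε hε
  obtain ⟨δ, hδ, H⟩ := h p hp ε hε
  refine ⟨δ, hδ, fun q hq hd => ?_⟩
  have h1 := ((comp_le_L (sub (F q.1 q.2) (F p.1 p.2)) n w).trans (L_le_N _ _)).trans_lt (H q hq hd)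
  rw [← ofReal_norm, ENNReal.ofReal_lt_ofReal_iff hε] at h1
  simpa [sub, dist_eq_norm] using h1

theorem bdd_N {F : ℝ → ℝ → TS d} {A : Set (ℝ × ℝ)} (hA : IsCompact A) (h : Cont1On F A)
    (hf : ∀ p ∈ A, pNorm 1 (F p.1 p.2) ≠ ⊤) :
    ∃ K : ℝ≥0∞, K ≠ ⊤ ∧ ∀ p ∈ A, pNorm 1 (F p.1 p.2) ≤ K := by
  refine hA.induction_on (p := fun B => ∃ K : ℝ≥0∞, K ≠ ⊤ ∧ ∀ p ∈ B, pNorm 1 (F p.1 p.2) ≤ K)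
    ⟨0, by simp, by simp⟩ ?_ ?_ ?_
  · rintro s t hst ⟨K, hK, H⟩
    exact ⟨K, hK, fun p hp => H p (hst hp)⟩
  · rintro s t ⟨K, hK, H⟩ ⟨K', hK', H'⟩
    refine ⟨K + K', ENNReal.add_ne_top.2 ⟨hK, hK'⟩, ?_⟩
    rintro p (hp | hp)
    · exact (H p hp).trans le_self_add
    · exact (H' p hp).trans le_add_self
  · intro p hp
    obtain ⟨δ, hδ, H⟩ := h p hp 1 one_pos
    refine ⟨A ∩ Metric.ball p δ, Filter.inter_mem self_mem_nhdsWithin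
      (mem_nhdsWithin_of_mem_nhds (Metric.ball_mem_nhds p hδ)),
      1 + pNorm 1 (F p.1 p.2), ENNReal.add_ne_top.2 ⟨by simp, hf p hp⟩, ?_⟩
    rintro q ⟨hq, hd⟩
    refine (N_tri _ (F p.1 p.2)).trans ?_
    gcongr
    simpa using (H q hq hd).le

theorem fld_zero (u : ℝ) (φ ψ y : TS d) (hy : ∀ w, y 0 w = 0) (w : Word d 0) :
    fld u φ ψ y 0 w = 0 := by
  simp [fld, add, smul, mul, reduce, hy]

end TS

open scoped BigOperators ENNReal
open MeasureTheory

/-- **A priori bound for the extended PDE system** (with general boundary data): if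
`(u, φ, φ̃) : [0,T]² → ℝ × 𝒯^1 × 𝒯^1` is a continuous solution of the integral system with
characteristics `𝔶, 𝔶̃` of finite `‖·‖_1`-integral `C_t, C̃_t`, then
`|u(s,t)| + ‖φ(s,t)‖_1 ≤ ψ(C_s, C̃_t) · sup_{[0,s]×[0,t]} |u(r,0) + u(0,v) − u(0,0)|`,
and the same with `φ̃` in place of `φ`, where `ψ(x,y) = e^{x+y} I₀(2√(xy))`. -/
theorem apriori_bound (d : ℕ) (T : ℝ) (hT : 0 < T) (y yt : ℝ → TS d)
    (hy0 : ∀ u w, y u 0 w = 0) (hyt0 : ∀ u w, yt u 0 w = 0)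
    (hymeas : ∀ n w, Measurable fun u => y u n w)
    (hytmeas : ∀ n w, Measurable fun u => yt u n w)
    (hyfin : ∀ t ∈ Set.Icc (0:ℝ) T, ∫⁻ r in Set.Ioc (0:ℝ) t, TS.pNorm 1 (y r) ≠ ⊤)
    (hytfin : ∀ t ∈ Set.Icc (0:ℝ) T, ∫⁻ r in Set.Ioc (0:ℝ) t, TS.pNorm 1 (yt r) ≠ ⊤)
    (u : ℝ → ℝ → ℝ) (φ φt : ℝ → ℝ → TS d)
    -- continuity of the solution triplet
    (hucont : ContinuousOn (fun p : ℝ × ℝ => u p.1 p.2) (Set.Icc 0 T ×ˢ Set.Icc 0 T))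
    (hφcont : TS.Cont1On φ (Set.Icc 0 T ×ˢ Set.Icc 0 T))
    (hφtcont : TS.Cont1On φt (Set.Icc 0 T ×ˢ Set.Icc 0 T))
    -- values in 𝒯^1
    (hφ1 : ∀ s ∈ Set.Icc (0:ℝ) T, ∀ t ∈ Set.Icc (0:ℝ) T,
      TS.pNorm 1 (φ s t) ≠ ⊤ ∧ TS.pNorm 1 (φt s t) ≠ ⊤)
    -- the integral system with general boundary data
    (hu : ∀ s ∈ Set.Icc (0:ℝ) T, ∀ t ∈ Set.Icc (0:ℝ) T,
      u s t = u s 0 + u 0 t - u 0 0 + ∫ r in (0:ℝ)..s, ∫ v in (0:ℝ)..t,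
        (u r v * TS.pairing (y r) (yt v)
          + TS.pairing (φ r v) (TS.reduce (TS.adjR (y r) (yt v)))
          + TS.pairing (φt r v) (TS.reduce (TS.adjR (yt v) (y r)))))
    (hφ : ∀ s ∈ Set.Icc (0:ℝ) T, ∀ t ∈ Set.Icc (0:ℝ) T, ∀ n w,
      φ s t n w = ∫ r in (0:ℝ)..s,
        (TS.add (TS.add (TS.smul (u r t) (y r)) (TS.mul (φ r t) (y r)))
          (TS.reduce (TS.adjL (φt r t) (y r)))) n w)
    (hφt : ∀ s ∈ Set.Icc (0:ℝ) T, ∀ t ∈ Set.Icc (0:ℝ) T, ∀ n w,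
      φt s t n w = ∫ r in (0:ℝ)..t,
        (TS.add (TS.add (TS.smul (u s r) (yt r)) (TS.mul (φt s r) (yt r)))
          (TS.reduce (TS.adjL (φ s r) (yt r)))) n w) :
    ∀ s ∈ Set.Icc (0:ℝ) T, ∀ t ∈ Set.Icc (0:ℝ) T,
      (|u s t| + (TS.pNorm 1 (φ s t)).toReal ≤
        Real.exp ((∫⁻ r in Set.Ioc (0:ℝ) s, TS.pNorm 1 (y r)).toReal
            + (∫⁻ v in Set.Ioc (0:ℝ) t, TS.pNorm 1 (yt v)).toReal) *
          besselI0 (2 * Real.sqrt ((∫⁻ r in Set.Ioc (0:ℝ) s, TS.pNorm 1 (y r)).toReal *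
            (∫⁻ v in Set.Ioc (0:ℝ) t, TS.pNorm 1 (yt v)).toReal)) *
          sSup ((fun p : ℝ × ℝ => |u p.1 0 + u 0 p.2 - u 0 0|) ''
            (Set.Icc 0 s ×ˢ Set.Icc 0 t))) ∧
      (|u s t| + (TS.pNorm 1 (φt s t)).toReal ≤
        Real.exp ((∫⁻ r in Set.Ioc (0:ℝ) s, TS.pNorm 1 (y r)).toReal
            + (∫⁻ v in Set.Ioc (0:ℝ) t, TS.pNorm 1 (yt v)).toReal) *
          besselI0 (2 * Real.sqrt ((∫⁻ r in Set.Ioc (0:ℝ) s, TS.pNorm 1 (y r)).toReal *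
            (∫⁻ v in Set.Ioc (0:ℝ) t, TS.pNorm 1 (yt v)).toReal)) *
          sSup ((fun p : ℝ × ℝ => |u p.1 0 + u 0 p.2 - u 0 0|) ''
            (Set.Icc 0 s ×ˢ Set.Icc 0 t))) := by
  set A : Set (ℝ × ℝ) := Set.Icc 0 T ×ˢ Set.Icc 0 T with hA
  have hAc : IsCompact A := isCompact_Icc.prod isCompact_Icc
  obtain ⟨K1, hK1, hb1⟩ := TS.bdd_N hAc hφcont (fun p hp => (hφ1 p.1 hp.1 p.2 hp.2).1)
  obtain ⟨K2, hK2, hb2⟩ := TS.bdd_N hAc hφtcont (fun p hp => (hφ1 p.1 hp.1 p.2 hp.2).2)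
  obtain ⟨K0, hb0⟩ := hAc.exists_bound_of_continuousOn hucont
  have hay := TS.measurable_N y hymeas
  have hayt := TS.measurable_N yt hytmeas
  set K : ℝ≥0∞ := ENNReal.ofReal K0 + K1 + K2 with hKdef
  have hKt : K ≠ ⊤ := by simp [hKdef, hK1, hK2]
  have hK : ∀ s ∈ Set.Icc (0:ℝ) T, ∀ t ∈ Set.Icc (0:ℝ) T,
      ‖u s t‖ₑ + TS.pNorm 1 (φ s t) + TS.pNorm 1 (φt s t) ≤ K := by
    intro s hs t ht
    refine add_le_add (add_le_add ?_ (hb1 (s, t) ⟨hs, ht⟩)) (hb2 (s, t) ⟨hs, ht⟩)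
    rw [← ofReal_norm]
    exact ENNReal.ofReal_le_ofReal (hb0 (s, t) ⟨hs, ht⟩)
  have hK' : ∀ s ∈ Set.Icc (0:ℝ) T, ∀ t ∈ Set.Icc (0:ℝ) T,
      ‖u s t‖ₑ + TS.pNorm 1 (φt s t) + TS.pNorm 1 (φ s t) ≤ K := by
    intro s hs t ht
    rw [add_right_comm]; exact hK s hs t ht
  -- sections
  have csec1 : ∀ {f : ℝ → ℝ → ℝ}, ContinuousOn (fun p : ℝ × ℝ => f p.1 p.2) A →
      ∀ s ∈ Set.Icc (0:ℝ) T, ∀ t ∈ Set.Icc (0:ℝ) T,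
      AEMeasurable (fun r => f r t) (volume.restrict (Set.Ioc 0 s)) := by
    intro f hf s hs t ht
    refine ContinuousOn.aemeasurable ?_ measurableSet_Ioc
    exact hf.comp (f := fun r : ℝ => (r, t)) (by fun_prop)
      (fun r hr => ⟨⟨hr.1.le, hr.2.trans hs.2⟩, ht⟩)
  have csec2 : ∀ {f : ℝ → ℝ → ℝ}, ContinuousOn (fun p : ℝ × ℝ => f p.1 p.2) A →
      ∀ s ∈ Set.Icc (0:ℝ) T, ∀ t ∈ Set.Icc (0:ℝ) T,
      AEMeasurable (fun r => f s r) (volume.restrict (Set.Ioc 0 t)) := by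
    intro f hf s hs t ht
    refine ContinuousOn.aemeasurable ?_ measurableSet_Ioc
    exact hf.comp (f := fun r : ℝ => (s, r)) (by fun_prop)
      (fun r hr => ⟨hs, ⟨hr.1.le, hr.2.trans ht.2⟩⟩)
  have hyae : ∀ s ∈ Set.Icc (0:ℝ) T,
      ∀ᵐ r ∂(volume.restrict (Set.Ioc 0 s)), TS.pNorm 1 (y r) ≠ ⊤ := by
    intro s hs
    filter_upwards [ae_lt_top hay (hyfin s hs)] with r hr using hr.ne
  have hytae : ∀ s ∈ Set.Icc (0:ℝ) T,
      ∀ᵐ r ∂(volume.restrict (Set.Ioc 0 s)), TS.pNorm 1 (yt r) ≠ ⊤ := by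
    intro s hs
    filter_upwards [ae_lt_top hayt (hytfin s hs)] with r hr using hr.ne
  have hφ' : ∀ s ∈ Set.Icc (0:ℝ) T, ∀ t ∈ Set.Icc (0:ℝ) T, ∀ n w,
      φ s t n w = ∫ r in Set.Ioc 0 s, TS.fld (u r t) (φ r t) (φt r t) (y r) n w := by
    intro s hs t ht n w
    rw [hφ s hs t ht n w, intervalIntegral.integral_of_le hs.1]; rfl
  have hφt' : ∀ s ∈ Set.Icc (0:ℝ) T, ∀ t ∈ Set.Icc (0:ℝ) T, ∀ n w,
      φt s t n w = ∫ r in Set.Ioc 0 t, TS.fld (u s r) (φt s r) (φ s r) (yt r) n w := by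
    intro s hs t ht n w
    rw [hφt s hs t ht n w, intervalIntegral.integral_of_le ht.1]; rfl
  have hφ0 : ∀ s ∈ Set.Icc (0:ℝ) T, ∀ t ∈ Set.Icc (0:ℝ) T, ∀ w, φ s t 0 w = 0 := by
    intro s hs t ht w
    rw [hφ' s hs t ht]
    simp_rw [TS.fld_zero _ _ _ _ (hy0 _)]
    simp
  have hφt0 : ∀ s ∈ Set.Icc (0:ℝ) T, ∀ t ∈ Set.Icc (0:ℝ) T, ∀ w, φt s t 0 w = 0 := by
    intro s hs t ht w
    rw [hφt' s hs t ht]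
    simp_rw [TS.fld_zero _ _ _ _ (hyt0 _)]
    simp
  -- fields
  have m1 : ∀ s ∈ Set.Icc (0:ℝ) T, ∀ t ∈ Set.Icc (0:ℝ) T, ∀ n w,
      AEMeasurable (fun r => TS.fld (u r t) (φ r t) (φt r t) (y r) n w)
        (volume.restrict (Set.Ioc 0 s)) := by
    intro s hs t ht
    refine TS.fld_meas _ _ _ _ (csec1 hucont s hs t ht)
      (fun n w => csec1 (f := fun a b => φ a b n w) (TS.comp_cont hφcont n w) s hs t ht)
      (fun n w => csec1 (f := fun a b => φt a b n w) (TS.comp_cont hφtcont n w) s hs t ht)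
      (fun n w => (hymeas n w).aemeasurable) ?_ (hyae s hs)
    refine ae_restrict_of_forall_mem measurableSet_Ioc fun r hr => ?_
    exact (hφ1 r ⟨hr.1.le, hr.2.trans hs.2⟩ t ht).2
  have m2 : ∀ s ∈ Set.Icc (0:ℝ) T, ∀ t ∈ Set.Icc (0:ℝ) T, ∀ n w,
      AEMeasurable (fun r => TS.fld (u s r) (φt s r) (φ s r) (yt r) n w)
        (volume.restrict (Set.Ioc 0 t)) := by
    intro s hs t ht
    refine TS.fld_meas _ _ _ _ (csec2 hucont s hs t ht)
      (fun n w => csec2 (f := fun a b => φt a b n w) (TS.comp_cont hφtcont n w) s hs t ht)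
      (fun n w => csec2 (f := fun a b => φ a b n w) (TS.comp_cont hφcont n w) s hs t ht)
      (fun n w => (hytmeas n w).aemeasurable) ?_ (hytae t ht)
    refine ae_restrict_of_forall_mem measurableSet_Ioc fun r hr => ?_
    exact (hφ1 s hs r ⟨hr.1.le, hr.2.trans ht.2⟩).1
  have f1 : ∀ s ∈ Set.Icc (0:ℝ) T, ∀ t ∈ Set.Icc (0:ℝ) T,
      ∫⁻ r in Set.Ioc 0 s, TS.pNorm 1 (TS.fld (u r t) (φ r t) (φt r t) (y r)) ≠ ⊤ := by
    intro s hs t ht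
    refine TS.fld_fin _ _ _ _ K hKt ?_ (hyfin s hs)
    exact ae_restrict_of_forall_mem measurableSet_Ioc fun r hr =>
      hK r ⟨hr.1.le, hr.2.trans hs.2⟩ t ht
  have f2 : ∀ s ∈ Set.Icc (0:ℝ) T, ∀ t ∈ Set.Icc (0:ℝ) T,
      ∫⁻ r in Set.Ioc 0 t, TS.pNorm 1 (TS.fld (u s r) (φt s r) (φ s r) (yt r)) ≠ ⊤ := by
    intro s hs t ht
    refine TS.fld_fin _ _ _ _ K hKt ?_ (hytfin t ht)
    exact ae_restrict_of_forall_mem measurableSet_Ioc fun r hr =>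
      hK' s hs r ⟨hr.1.le, hr.2.trans ht.2⟩
  have n1 : ∀ s ∈ Set.Icc (0:ℝ) T, ∀ t ∈ Set.Icc (0:ℝ) T, TS.pNorm 1 (φ s t) ≤
      ∫⁻ r in Set.Ioc 0 s, TS.pNorm 1 (TS.fld (u r t) (φ r t) (φt r t) (y r)) :=
    fun s hs t ht => TS.N_integral (m1 s hs t ht) (f1 s hs t ht) _ (hφ' s hs t ht)
  have n2 : ∀ s ∈ Set.Icc (0:ℝ) T, ∀ t ∈ Set.Icc (0:ℝ) T, TS.pNorm 1 (φt s t) ≤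
      ∫⁻ r in Set.Ioc 0 t, TS.pNorm 1 (TS.fld (u s r) (φt s r) (φ s r) (yt r)) :=
    fun s hs t ht => TS.N_integral (m2 s hs t ht) (f2 s hs t ht) _ (hφt' s hs t ht)
  have hu' : ∀ s ∈ Set.Icc (0:ℝ) T, ∀ t ∈ Set.Icc (0:ℝ) T,
      u s t = u s 0 + u 0 t - u 0 0 + ∫ r in Set.Ioc 0 s, TS.pairing (y r) (φt r t) := by
    intro s hs t ht
    rw [hu s hs t ht, intervalIntegral.integral_of_le hs.1]
    congr 1
    refine integral_congr_ae ?_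
    filter_upwards [hyae s hs, ae_restrict_mem measurableSet_Ioc] with r hr1 hr2
    have hr : r ∈ Set.Icc (0:ℝ) T := ⟨hr2.1.le, hr2.2.trans hs.2⟩
    rw [intervalIntegral.integral_of_le ht.1,
      TS.pairing_integral (m2 r hr t ht) (f2 r hr t ht) _ (hφt' r hr t ht) (y r) hr1]
    refine integral_congr_ae ?_
    filter_upwards [hytae t ht, ae_restrict_mem measurableSet_Ioc] with v hv1 hv2
    have hv : v ∈ Set.Icc (0:ℝ) T := ⟨hv2.1.le, hv2.2.trans ht.2⟩
    rw [TS.pairing_fld _ _ _ _ _ (hφ1 r hr v hv).2 (hφ1 r hr v hv).1 hv1 hr1 (hy0 r)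
      (hφt0 r hr v hv) (hφ0 r hr v hv)]
  intro s hs t ht
  set M : ℝ := sSup ((fun p : ℝ × ℝ => |u p.1 0 + u 0 p.2 - u 0 0|) ''
            (Set.Icc 0 s ×ˢ Set.Icc 0 t)) with hM
  have h0 : (0:ℝ) ∈ Set.Icc (0:ℝ) T := ⟨le_rfl, hT.le⟩
  have hMb : ∀ r ∈ Set.Icc (0:ℝ) s, ∀ v ∈ Set.Icc (0:ℝ) t, |u r 0 + u 0 v - u 0 0| ≤ M := by
    intro r hr v hv
    refine le_csSup ?_ ⟨(r, v), ⟨hr, hv⟩, rfl⟩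
    refine ⟨K0 + K0 + K0, ?_⟩
    rintro _ ⟨p, hp, rfl⟩
    have a1 := hb0 (p.1, 0) ⟨⟨hp.1.1, hp.1.2.trans hs.2⟩, h0⟩
    have a2 := hb0 (0, p.2) ⟨h0, ⟨hp.2.1, hp.2.2.trans ht.2⟩⟩
    have a3 := hb0 (0, 0) ⟨h0, h0⟩
    simp only [Real.norm_eq_abs] at a1 a2 a3
    exact (abs_sub _ _).trans (add_le_add ((abs_add_le _ _).trans (add_le_add a1 a2)) a3)
  have hM0 : 0 ≤ M := (abs_nonneg _).trans (hMb 0 ⟨le_rfl, hs.1⟩ 0 ⟨le_rfl, ht.1⟩)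
  have key := gron_final (fun r => TS.pNorm 1 (y r)) (fun r => TS.pNorm 1 (yt r)) hay hayt s t
    hs.1 ht.1 (hyfin s hs) (hytfin t ht)
    (fun s t => ‖u s t‖ₑ + TS.pNorm 1 (φ s t) + TS.pNorm 1 (φt s t)) (ENNReal.ofReal M) K hKt
    (fun r hr v hv => hK r ⟨hr.1, hr.2.trans hs.2⟩ v ⟨hv.1, hv.2.trans ht.2⟩) (by
      intro r hr v hv
      have hr' : r ∈ Set.Icc (0:ℝ) T := ⟨hr.1, hr.2.trans hs.2⟩
      have hv' : v ∈ Set.Icc (0:ℝ) T := ⟨hv.1, hv.2.trans ht.2⟩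
      have e1 : ‖u r v‖ₑ ≤ ENNReal.ofReal M +
          ∫⁻ x in Set.Ioc 0 r, ‖TS.pairing (y x) (φt x v)‖ₑ := by
        rw [hu' r hr' v hv']
        refine (enorm_add_le _ _).trans (add_le_add ?_ (enorm_integral_le_lintegral_enorm _))
        rw [← ofReal_norm]
        exact ENNReal.ofReal_le_ofReal (hMb r hr v hv)
      have e2 : (∫⁻ x in Set.Ioc 0 r, ‖TS.pairing (y x) (φt x v)‖ₑ) +
          (∫⁻ x in Set.Ioc 0 r, TS.pNorm 1 (TS.fld (u x v) (φ x v) (φt x v) (y x))) ≤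
          ∫⁻ x in Set.Ioc 0 r, TS.pNorm 1 (y x) *
            (‖u x v‖ₑ + TS.pNorm 1 (φ x v) + TS.pNorm 1 (φt x v)) :=
        (le_lintegral_add _ _).trans (lintegral_mono fun x => TS.fld_bound _ _ _ _)
      have e3 : (∫⁻ x in Set.Ioc 0 v, TS.pNorm 1 (TS.fld (u r x) (φt r x) (φ r x) (yt x))) ≤
          ∫⁻ x in Set.Ioc 0 v, TS.pNorm 1 (yt x) *
            (‖u r x‖ₑ + TS.pNorm 1 (φ r x) + TS.pNorm 1 (φt r x)) := by
        refine lintegral_mono fun x => ?_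
        refine (le_add_self.trans (TS.fld_bound _ _ _ _)).trans (le_of_eq ?_)
        ring
      refine add_le_add ?_ ((n2 r hr' v hv').trans e3)
      refine (add_le_add e1 (n1 r hr' v hv')).trans ?_
      rw [add_assoc]
      exact add_le_add_right e2 _)
  set Ψ : ℝ := Real.exp ((∫⁻ r in Set.Ioc (0:ℝ) s, TS.pNorm 1 (y r)).toReal
            + (∫⁻ v in Set.Ioc (0:ℝ) t, TS.pNorm 1 (yt v)).toReal) *
          besselI0 (2 * Real.sqrt ((∫⁻ r in Set.Ioc (0:ℝ) s, TS.pNorm 1 (y r)).toReal *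
            (∫⁻ v in Set.Ioc (0:ℝ) t, TS.pNorm 1 (yt v)).toReal)) with hΨ
  have hΨ0 : 0 ≤ Ψ := by
    refine mul_nonneg (Real.exp_pos _).le (tsum_nonneg fun k => ?_)
    positivity
  rw [← ENNReal.ofReal_mul hΨ0] at key
  have fin : ∀ z : TS d, TS.pNorm 1 z ≠ ⊤ → ‖u s t‖ₑ + TS.pNorm 1 z ≤ ENNReal.ofReal (Ψ * M) →
      |u s t| + (TS.pNorm 1 z).toReal ≤ Ψ * M := by
    intro z hz h
    have := ENNReal.toReal_mono ENNReal.ofReal_ne_top h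
    rwa [ENNReal.toReal_add (by simp) hz, toReal_enorm, Real.norm_eq_abs,
      ENNReal.toReal_ofReal (mul_nonneg hΨ0 hM0)] at this
  refine ⟨fin _ (hφ1 s hs t ht).1 (le_trans le_self_add key),
    fin _ (hφ1 s hs t ht).2 (le_trans ?_ key)⟩
  rw [add_right_comm]
  exact le_self_add
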